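/- There is a universal constant C such that for every n-vertex graph G with maximum degree Δ, when Algorithm 1 is run on G producing the matching M, the expected number of vertices v ∈ V with residual degree deg^res_M(v) > Δ^{0.99} is at most C·n/Δ^{0.03}. -/

import Mathlib

open Finset
open scoped Classical

section Defs

private lemma sym2_exists_mem {V : Type*} (e : Sym2 V) : ∃ a, a ∈ e :=
  ⟨(Quot.out e).1, Sym2.out_fst_mem e⟩

variable {V : Type*} [Fintype V] [DecidableEq V]

/-- The greedy maximal matching of the graph with edge set `E`, processing edges in
increasing order of the priority function `ρ`: repeatedly pick the minimum-priority
remaining edge, add it to the matching, and discard all edges meeting it. -/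
noncomputable def greedyMM {β : Type*} [LinearOrder β] (ρ : Sym2 V → β) (E : Finset (Sym2 V)) :
    Finset (Sym2 V) :=
  if h : E.Nonempty then
    insert (Classical.choose (E.exists_min_image ρ h))
      (greedyMM ρ (E.filter fun f =>
        ¬ ∃ v, v ∈ Classical.choose (E.exists_min_image ρ h) ∧ v ∈ f))
  else ∅
termination_by E.card
decreasing_by
  have he : Classical.choose (E.exists_min_image ρ h) ∈ E :=
    (Classical.choose_spec (E.exists_min_image ρ h)).1
  apply Finset.card_lt_card
  refine (Finset.ssubset_iff_of_subset (Finset.filter_subset _ _)).2 ⟨_, he, ?_⟩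
  intro hmem
  obtain ⟨a, ha⟩ := sym2_exists_mem (Classical.choose (E.exists_min_image ρ h))
  exact (Finset.mem_filter.1 hmem).2 ⟨a, ha, ha⟩

/-- The set of vertices matched by a set `M` of edges. -/
noncomputable def matchedV (M : Finset (Sym2 V)) : Finset V :=
  Finset.univ.filter fun v => ∃ e ∈ M, v ∈ e

/-- Residual degree of `v` with respect to the matching `M` in the graph with edge set `E`:
`0` if `v` is matched, and otherwise the degree of `v` in the induced subgraph on
unmatched vertices. -/
noncomputable def resDeg (E M : Finset (Sym2 V)) (v : V) : ℕ :=
  if v ∈ matchedV M then 0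
  else (E.filter fun e => v ∈ e ∧ ∀ w ∈ e, w ∉ matchedV M).card

/-- The number of vertices whose match-status differs between `M` and `M'`. -/
noncomputable def statusDiff (M M' : Finset (Sym2 V)) : ℕ :=
  (Finset.univ.filter fun v => ¬ (v ∈ matchedV M ↔ v ∈ matchedV M')).card


/-- The endpoints of an edge, as a finset. -/
noncomputable def ends (e : Sym2 V) : Finset V := Finset.univ.filter (· ∈ e)

/-- The recursive edge oracle (with bookkeeping), for the graph with (sampled) edge set `L`
and priorities `π`, run with the partition-indicator vector `x`.
`eoQ π L x fuel e` returns a triple `(ans, qs, cnt)` where `ans` tells whether `e` joins the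
greedy matching of the induced subgraph of `L` on `{v | x v}`, `qs` is the set of entries of
`x` queried, and `cnt` is the number of (recursive) oracle calls made on edges of `L` having
both endpoints in `{v | x v}` (including the call on `e` itself, when applicable).
The oracle first queries the two endpoints of `e` and answers NO if one of them is outside
the part; otherwise it recursively evaluates the incident edges of `L` of smaller priority,
in increasing order of priority, stopping as soon as one of them answers YES.
It is always invoked with `fuel = π e + 1`, which guarantees the fuel never runs out. -/
noncomputable def eoQ (π : Sym2 V → ℕ) (L : Finset (Sym2 V)) (x : V → Bool) :
    ℕ → Sym2 V → Bool × Finset V × ℕ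
  | 0, e => (false, ends e, 0)
  | fuel + 1, e =>
    if ∀ v ∈ e, x v then
      let nbrs := ((L.filter fun f => f ≠ e ∧ (∃ v, v ∈ e ∧ v ∈ f) ∧ π f < π e).toList.mergeSort
          (fun a b => decide (π a ≤ π b)))
      let r := nbrs.foldl (fun (s : Bool × Finset V × ℕ) f =>
          if s.1 then s
          else
            let t := eoQ π L x fuel f
            (t.1, s.2.1 ∪ t.2.1, s.2.2 + t.2.2)) (false, ∅, 0)
      (!r.1, ends e ∪ r.2.1, (if e ∈ L then 1 else 0) + r.2.2)
    else (false, ends e, 0)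

/-- Whether `e` belongs to the greedy matching, as decided by the edge oracle. -/
noncomputable def edgeOracle (π : Sym2 V → ℕ) (L : Finset (Sym2 V)) (x : V → Bool)
    (e : Sym2 V) : Bool × Finset V × ℕ :=
  eoQ π L x (π e + 1) e

/-- The degree oracle for vertex `v`: determines `Z_{v,1}`, the number of neighbors of `v`
(in the graph with edge set `Ed`) lying in the part `{u | x u}` that are unmatched in the
greedy matching of the induced subgraph of `L`.  For each neighbor `u` of `v` it queries
`x u`, and if `x u = 1`, it runs the edge oracle on every edge of `L` incident to `u`.
Returns `(Z value, set of entries of x queried, number of oracle calls on edges inside the part)`. -/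
noncomputable def degOr (Ed : Finset (Sym2 V)) (π : Sym2 V → ℕ) (L : Finset (Sym2 V))
    (x : V → Bool) (v : V) : ℕ × Finset V × ℕ :=
  let Nv := Finset.univ.filter fun u => s(u, v) ∈ Ed
  let q := Nv ∪ (Nv.filter fun u => x u).biUnion fun u =>
      (Finset.univ.filter fun w => s(u, w) ∈ L).biUnion fun w =>
        (edgeOracle π L x s(u, w)).2.1
  let c := ∑ u ∈ Nv.filter (fun u => x u), ∑ w ∈ Finset.univ.filter (fun w => s(u, w) ∈ L),
        (edgeOracle π L x s(u, w)).2.2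
  ((Nv.filter fun u => x u ∧ ∀ w ∈ Finset.univ.filter (fun w => s(u, w) ∈ L),
      (edgeOracle π L x s(u, w)).1 = false).card, q, c)

/-- `B v`: the number of entries of `x` queried during the execution of the degree oracle. -/
noncomputable def Bqueries (Ed : Finset (Sym2 V)) (π : Sym2 V → ℕ) (L : Finset (Sym2 V))
    (x : V → Bool) (v : V) : ℕ :=
  (degOr Ed π L x v).2.1.card

/-- The priority function on edges induced by a permutation `τ` of `Fin E.card`,
via the canonical enumeration of `E`; edges outside `E` get priority `0`. -/
noncomputable def prioOf (E : Finset (Sym2 V)) (τ : Equiv.Perm (Fin E.card)) (e : Sym2 V) : ℕ :=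
  if h : e ∈ E then (τ (E.equivFin ⟨e, h⟩) : ℕ) else 0

/-- `L₁`: the set of edges of `L` with both endpoints inside the part `{v | x v}`. -/
noncomputable def partEdges (L : Finset (Sym2 V)) (x : V → Bool) : Finset (Sym2 V) :=
  L.filter fun e => ∀ v ∈ e, x v

/-- `Z_{v,1}(x)`: the number of neighbors of `v` in the graph `Ed` lying in the part
`{u | x u}` that are unmatched in `M₁ = GreedyMM(L₁, π)`. -/
noncomputable def Zv1 (Ed : Finset (Sym2 V)) (π : Sym2 V → ℕ) (L : Finset (Sym2 V))
    (x : V → Bool) (v : V) : ℕ :=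
  (Finset.univ.filter fun u =>
    s(u, v) ∈ Ed ∧ x u ∧ u ∉ matchedV (greedyMM π (partEdges L x))).card


/-- The matching output by Algorithm 1: the union over all parts `i ∈ [k]` of the greedy
maximal matching (w.r.t. the priorities `π`) of the induced subgraph of the sampled edge
set `L` on the part `V_i = χ⁻¹(i)`. -/
noncomputable def algoMatching (π : Sym2 V → ℕ) (k : ℕ) (χ : V → Fin k)
    (L : Finset (Sym2 V)) : Finset (Sym2 V) :=
  (Finset.univ : Finset (Fin k)).biUnion fun i =>
    greedyMM π (L.filter fun e => ∀ w ∈ e, χ w = i)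

/-- `Z_{v,i}`: the number of neighbors of `v` in the graph `Ed` that lie in part `V_i`
and are unmatched in the matching `M` output by Algorithm 1. -/
noncomputable def Zvi (Ed : Finset (Sym2 V)) (π : Sym2 V → ℕ) (k : ℕ) (χ : V → Fin k)
    (L : Finset (Sym2 V)) (v : V) (i : Fin k) : ℕ :=
  (Finset.univ.filter fun u =>
    s(u, v) ∈ Ed ∧ χ u = i ∧ u ∉ matchedV (algoMatching π k χ L)).card

/-- `Z'_v`: equal to `Z_{v, χ(v)}` if `v` is unmatched in the output `M` of Algorithm 1,
and `0` if `v` is matched in `M`. -/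
noncomputable def Zself (Ed : Finset (Sym2 V)) (π : Sym2 V → ℕ) (k : ℕ) (χ : V → Fin k)
    (L : Finset (Sym2 V)) (v : V) : ℕ :=
  if v ∈ matchedV (algoMatching π k χ L) then 0 else Zvi Ed π k χ L v (χ v)

/-- The Bernoulli product weight of the edge sample `S ⊆ Ed`, each edge kept with
probability `p`. -/
noncomputable def bwE (p : ℝ) (Ed S : Finset (Sym2 V)) : ℝ :=
  p ^ S.card * (1 - p) ^ (Ed.card - S.card)

/-- The Bernoulli product weight of the indicator vector `x : V → Bool`, each coordinate
equal to `true` independently with probability `q`. -/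
noncomputable def bwX (q : ℝ) (x : V → Bool) : ℝ :=
  q ^ (Finset.univ.filter fun v => x v = true).card *
    (1 - q) ^ (Finset.univ.filter fun v => x v = false).card

end Defs

universe u

/-- `M` consists of exactly those edges of `S` that meet no edge of `M` of smaller priority. -/
def IsGreedyMatching {V : Type*} (ρ : Sym2 V → ℕ) (S M : Finset (Sym2 V)) : Prop :=
  M ⊆ S ∧ ∀ e ∈ S, (e ∈ M ↔ ∀ f ∈ M, ρ f < ρ e → ¬ ∃ v, v ∈ f ∧ v ∈ e)

theorem IsGreedyMatching.eq {V : Type*} {ρ : Sym2 V → ℕ} {S M M' : Finset (Sym2 V)} (h : IsGreedyMatching ρ S M)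
    (h' : IsGreedyMatching ρ S M') : M = M' := by
  have key : ∀ n, ∀ e ∈ S, ρ e = n → (e ∈ M ↔ e ∈ M') := by
    intro n
    induction n using Nat.strong_induction_on with
    | _ n ih =>
      intro e he hn
      rw [h.2 e he, h'.2 e he]
      constructor
      · intro hM f hf hlt
        exact hM f ((ih _ (hn ▸ hlt) f (h'.1 hf) rfl).2 hf) hlt
      · intro hM f hf hlt
        exact hM f ((ih _ (hn ▸ hlt) f (h.1 hf) rfl).1 hf) hlt
  ext e
  exact ⟨fun he => (key _ e (h.1 he) rfl).1 he, fun he => (key _ e (h'.1 he) rfl).2 he⟩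

section GreedyMatching

variable {V : Type*} [Fintype V] [DecidableEq V] {ρ : Sym2 V → ℕ}

theorem mem_matchedV {M : Finset (Sym2 V)} {v : V} : v ∈ matchedV M ↔ ∃ e ∈ M, v ∈ e := by
  simp [matchedV]

theorem greedyMM_empty (ρ : Sym2 V → ℕ) : greedyMM ρ ∅ = ∅ := by
  rw [greedyMM]; simp

theorem greedyMM_eq_insert {S : Finset (Sym2 V)} (hρ : Set.InjOn ρ S) {e : Sym2 V} (he : e ∈ S)
    (hmin : ∀ f ∈ S, ρ e ≤ ρ f) :
    greedyMM ρ S = insert e (greedyMM ρ (S.filter fun f => ¬ ∃ v, v ∈ e ∧ v ∈ f)) := by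
  rw [greedyMM, dif_pos ⟨e, he⟩]
  have h := Classical.choose_spec (S.exists_min_image ρ ⟨e, he⟩)
  have heq : Classical.choose (S.exists_min_image ρ ⟨e, he⟩) = e :=
    hρ h.1 he (le_antisymm (h.2 e he) (hmin _ h.1))
  rw [heq]

theorem isGreedyMatching_greedyMM (S : Finset (Sym2 V)) (hρ : Set.InjOn ρ S) :
    IsGreedyMatching ρ S (greedyMM ρ S) := by
  induction S using Finset.strongInduction with
  | H S ih =>
    rcases S.eq_empty_or_nonempty with rfl | hS
    · rw [greedyMM_empty]; simp [IsGreedyMatching]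
    obtain ⟨m, hm, hmin⟩ := S.exists_min_image ρ hS
    set S' := S.filter fun f => ¬ ∃ v, v ∈ m ∧ v ∈ f with hS'
    have hsub : S' ⊆ S := Finset.filter_subset _ _
    have hss : S' ⊂ S := by
      refine (Finset.ssubset_iff_of_subset hsub).2 ⟨m, hm, fun h => ?_⟩
      exact (Finset.mem_filter.1 h).2 ⟨_, Sym2.out_fst_mem m, Sym2.out_fst_mem m⟩
    obtain ⟨h1, h2⟩ := ih S' hss (hρ.mono (Finset.coe_subset.2 hsub))
    rw [greedyMM_eq_insert hρ hm hmin, ← hS']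
    set M := greedyMM ρ S'
    refine ⟨Finset.insert_subset hm (h1.trans hsub), fun e he => ?_⟩
    by_cases hem : e = m
    · subst hem
      simp only [Finset.mem_insert_self, true_iff]
      intro f hf hlt
      have : f ∈ S := (Finset.insert_subset hm (h1.trans hsub)) hf
      exact absurd (hmin f this) (not_le.2 hlt)
    by_cases hmeet : ∃ v, v ∈ m ∧ v ∈ e
    · have hlt : ρ m < ρ e :=
        lt_of_le_of_ne (hmin e he) fun h => hem (hρ hm he h).symm
      constructor
      · intro h
        have := h1 ((Finset.mem_insert.1 h).resolve_left hem)
        exact absurd hmeet (Finset.mem_filter.1 this).2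
      · intro h
        exact absurd hmeet (h m (Finset.mem_insert_self _ _) hlt)
    · have heS' : e ∈ S' := Finset.mem_filter.2 ⟨he, hmeet⟩
      rw [Finset.mem_insert, or_iff_right hem, h2 e heS', Finset.forall_mem_insert]
      exact ⟨fun h => ⟨fun _ => hmeet, h⟩, fun h => h.2⟩

theorem greedyMM_subset {S : Finset (Sym2 V)} (hρ : Set.InjOn ρ S) : greedyMM ρ S ⊆ S :=
  (isGreedyMatching_greedyMM S hρ).1

/-- Greedy matchings are matchings. -/
theorem eq_of_mem_greedyMM {S : Finset (Sym2 V)} (hρ : Set.InjOn ρ S) {e f : Sym2 V}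
    (he : e ∈ greedyMM ρ S) (hf : f ∈ greedyMM ρ S) {v : V} (hve : v ∈ e) (hvf : v ∈ f) :
    e = f := by
  obtain ⟨h1, h2⟩ := isGreedyMatching_greedyMM S hρ
  by_contra hne
  rcases lt_or_gt_of_ne fun h => hne (hρ (h1 he) (h1 hf) h) with hlt | hlt
  · exact (h2 f (h1 hf)).1 hf e he hlt ⟨v, hve, hvf⟩
  · exact (h2 e (h1 he)).1 he f hf hlt ⟨v, hvf, hve⟩

/-- Greedy matchings are maximal. -/
theorem notMem_of_forall_notMem_matchedV {S : Finset (Sym2 V)} (hρ : Set.InjOn ρ S) {e : Sym2 V}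
    (hun : ∀ w ∈ e, w ∉ matchedV (greedyMM ρ S)) : e ∉ S := by
  intro he
  have h2 := ((isGreedyMatching_greedyMM S hρ).2 e he).2 fun f hf _ ⟨v, hvf, hve⟩ =>
    hun v hve (mem_matchedV.2 ⟨f, hf, hvf⟩)
  exact hun _ (Sym2.out_fst_mem e) (mem_matchedV.2 ⟨e, h2, Sym2.out_fst_mem e⟩)

/-- An edge both of whose endpoints are left unmatched would be picked if it were added. -/
theorem greedyMM_insert_of_unmatched {S : Finset (Sym2 V)} {e : Sym2 V}
    (hρ : Set.InjOn ρ (insert e S : Finset (Sym2 V)))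
    (hun : ∀ w ∈ e, w ∉ matchedV (greedyMM ρ S)) :
    greedyMM ρ (insert e S) = insert e (greedyMM ρ S) := by
  have hρS : Set.InjOn ρ S := hρ.mono (Finset.coe_subset.2 (Finset.subset_insert _ _))
  obtain ⟨h1, h2⟩ := isGreedyMatching_greedyMM S hρS
  have heS := notMem_of_forall_notMem_matchedV hρS hun
  have hdisj : ∀ f ∈ greedyMM ρ S, ¬ ∃ v, v ∈ f ∧ v ∈ e := fun f hf ⟨v, hvf, hve⟩ =>
    hun v hve (mem_matchedV.2 ⟨f, hf, hvf⟩)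
  refine (isGreedyMatching_greedyMM _ hρ).eq ⟨Finset.insert_subset_insert _ h1, fun f hf => ?_⟩
  rw [Finset.forall_mem_insert]
  rcases Finset.mem_insert.1 hf with rfl | hf
  · simp only [Finset.mem_insert_self, true_iff]
    exact ⟨fun h => absurd h (lt_irrefl _), fun g hg _ => hdisj g hg⟩
  · have hne : f ≠ e := fun h => heS (h ▸ hf)
    rw [Finset.mem_insert, or_iff_right hne, h2 f hf]
    refine ⟨fun h => ⟨fun _ ⟨v, hve, hvf⟩ => ?_, h⟩, fun h => h.2⟩
    exact hdisj f ((h2 f hf).2 h) ⟨v, hvf, hve⟩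

/-- The set of vertices whose match status differs between `M` and `M'`. -/
noncomputable def statusChange (M M' : Finset (Sym2 V)) : Finset V :=
  symmDiff (matchedV M) (matchedV M')

theorem matchedV_insert (e : Sym2 V) (M : Finset (Sym2 V)) :
    matchedV (insert e M) = ends e ∪ matchedV M := by
  ext v; simp [matchedV, ends]

theorem statusChange_insert_insert {e : Sym2 V} {M M' : Finset (Sym2 V)}
    (h : ∀ v ∈ e, v ∉ matchedV M ∧ v ∉ matchedV M') :
    statusChange (insert e M) (insert e M') = statusChange M M' := by
  ext v
  simp only [statusChange, matchedV_insert, Finset.mem_symmDiff, Finset.mem_union, ends,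
    Finset.mem_filter, Finset.mem_univ, true_and]
  have := h v
  tauto

/-- Deleting a vertex changes the status of at most one other vertex, and of none unless the
vertex itself was matched. -/
theorem statusChange_delete_vertex (S : Finset (Sym2 V)) (hρ : Set.InjOn ρ S)
    (hdiag : ∀ e ∈ S, ¬ e.IsDiag) (a : V) :
    (statusChange (greedyMM ρ S) (greedyMM ρ (S.filter fun f => a ∉ f))).card ≤ 2 ∧
      ((statusChange (greedyMM ρ S) (greedyMM ρ (S.filter fun f => a ∉ f))).Nonempty →
        a ∈ statusChange (greedyMM ρ S) (greedyMM ρ (S.filter fun f => a ∉ f))) := by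
  induction S using Finset.strongInduction generalizing a with
  | H S ih =>
    rcases S.eq_empty_or_nonempty with rfl | hS
    · simp [greedyMM_empty, statusChange]
    obtain ⟨m, hm, hmin⟩ := S.exists_min_image ρ hS
    have hsub : ∀ (P : Sym2 V → Prop) [DecidablePred P], S.filter P ⊆ S := fun P _ => Finset.filter_subset _ _
    have hρ' : ∀ (P : Sym2 V → Prop) [DecidablePred P],
        Set.InjOn ρ (S.filter P : Finset (Sym2 V)) := fun P _ =>
      hρ.mono (Finset.coe_subset.2 (hsub P))
    have hmm : ∃ v, v ∈ m ∧ v ∈ m := ⟨_, Sym2.out_fst_mem m, Sym2.out_fst_mem m⟩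
    rw [greedyMM_eq_insert hρ hm hmin]
    by_cases ham : a ∈ m
    · obtain ⟨b, rfl⟩ := ham
      have hab : a ≠ b := fun h => hdiag _ hm (by simp [h])
      have hss : (S.filter fun f => a ∉ f) ⊂ S :=
        Finset.filter_ssubset.2 ⟨_, hm, by simp⟩
      have := ih _ hss (hρ' _) (fun e he => hdiag e (hsub _ he)) b
      have heq : (S.filter fun f => ¬ ∃ v, v ∈ s(a, b) ∧ v ∈ f) =
          (S.filter fun f => a ∉ f).filter fun f => b ∉ f := by
        ext f; simp [and_assoc]
      rw [heq]
      set N := greedyMM ρ ((S.filter fun f => a ∉ f).filter fun f => b ∉ f) with hN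
      set M' := greedyMM ρ (S.filter fun f => a ∉ f) with hM'
      have haN : a ∉ matchedV N := by
        rw [mem_matchedV]; rintro ⟨e, he, hae⟩
        have := greedyMM_subset ((hρ' _).mono (Finset.coe_subset.2 (Finset.filter_subset _ _))) he
        simp at this; tauto
      have hbN : b ∉ matchedV N := by
        rw [mem_matchedV]; rintro ⟨e, he, hae⟩
        have := greedyMM_subset ((hρ' _).mono (Finset.coe_subset.2 (Finset.filter_subset _ _))) he
        simp at this; tauto
      have haM' : a ∉ matchedV M' := by
        rw [mem_matchedV]; rintro ⟨e, he, hae⟩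
        have := greedyMM_subset (hρ' _) he
        simp at this; tauto
      have hD : statusChange (insert s(a, b) N) M' =
          insert a (symmDiff (statusChange M' N) {b}) := by
        ext v
        simp only [statusChange, matchedV_insert, Finset.mem_symmDiff, Finset.mem_union,
          Finset.mem_insert, Finset.mem_singleton, ends, Finset.mem_filter, Finset.mem_univ,
          true_and, Sym2.mem_iff]
        by_cases hva : v = a
        · subst hva; simp [haM']
        by_cases hvb : v = b
        · subst hvb; simp [hbN, hva]
        · simp [hva, hvb]; tauto
      rw [hD]
      refine ⟨?_, fun _ => Finset.mem_insert_self _ _⟩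
      refine (Finset.card_insert_le _ _).trans ?_
      suffices (symmDiff (statusChange M' N) {b}).card ≤ 1 by omega
      rcases (statusChange M' N).eq_empty_or_nonempty with h0 | h0
      · rw [h0, ← Finset.bot_eq_empty, bot_symmDiff, Finset.card_singleton]
      · have hb := this.2 h0
        have : symmDiff (statusChange M' N) {b} = (statusChange M' N).erase b := by
          ext v; simp only [Finset.mem_symmDiff, Finset.mem_singleton, Finset.mem_erase]
          constructor
          · rintro (h | ⟨rfl, h⟩)
            · tauto
            · exact absurd hb h
          · tauto
        rw [this, Finset.card_erase_of_mem hb]; omega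
    · have hmS' : m ∈ S.filter fun f => a ∉ f := Finset.mem_filter.2 ⟨hm, ham⟩
      rw [greedyMM_eq_insert (hρ' _) hmS' fun f hf => hmin f (hsub _ hf), Finset.filter_comm]
      have hss : (S.filter fun f => ¬ ∃ v, v ∈ m ∧ v ∈ f) ⊂ S :=
        Finset.filter_ssubset.2 ⟨m, hm, not_not.2 hmm⟩
      have hind := ih _ hss (hρ' _) (fun e he => hdiag e (hsub _ he)) a
      set N := greedyMM ρ (S.filter fun f => ¬ ∃ v, v ∈ m ∧ v ∈ f) with hN
      set N' := greedyMM ρ ((S.filter fun f => ¬ ∃ v, v ∈ m ∧ v ∈ f).filter fun f => a ∉ f)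
        with hN'
      have hdisj : ∀ v ∈ m, v ∉ matchedV N ∧ v ∉ matchedV N' := by
        intro v hv
        simp only [mem_matchedV]
        constructor
        · rintro ⟨e, he, hve⟩
          exact (Finset.mem_filter.1 (greedyMM_subset (hρ' _) he)).2 ⟨v, hv, hve⟩
        · rintro ⟨e, he, hve⟩
          have := greedyMM_subset
            ((hρ' _).mono (Finset.coe_subset.2 (Finset.filter_subset _ _))) he
          exact (Finset.mem_filter.1 (Finset.mem_filter.1 this).1).2 ⟨v, hv, hve⟩
      rw [statusChange_insert_insert hdisj]
      exact hind

end GreedyMatching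

section Bernoulli

variable {α : Type*}

/-- The expectation of `f A` for a random subset `A ⊆ W` containing each element of `W`
independently with probability `q`. -/
noncomputable def bernSum (q : ℝ) (W : Finset α) (f : Finset α → ℝ) : ℝ :=
  ∑ A ∈ W.powerset, q ^ A.card * (1 - q) ^ (W.card - A.card) * f A

theorem bernSum_congr {q : ℝ} {W : Finset α} {f g : Finset α → ℝ} (h : ∀ A ⊆ W, f A = g A) :
    bernSum q W f = bernSum q W g :=
  Finset.sum_congr rfl fun A hA => by rw [h A (Finset.mem_powerset.1 hA)]

theorem bernSum_mono {q : ℝ} (h0 : 0 ≤ q) (h1 : q ≤ 1) {W : Finset α} {f g : Finset α → ℝ}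
    (h : ∀ A ⊆ W, f A ≤ g A) : bernSum q W f ≤ bernSum q W g :=
  Finset.sum_le_sum fun A hA => mul_le_mul_of_nonneg_left (h A (Finset.mem_powerset.1 hA))
    (mul_nonneg (pow_nonneg h0 _) (pow_nonneg (sub_nonneg.2 h1) _))

theorem bernSum_add (q : ℝ) (W : Finset α) (f g : Finset α → ℝ) :
    bernSum q W (fun A => f A + g A) = bernSum q W f + bernSum q W g := by
  simp [bernSum, mul_add, Finset.sum_add_distrib]

theorem bernSum_sub (q : ℝ) (W : Finset α) (f g : Finset α → ℝ) :
    bernSum q W (fun A => f A - g A) = bernSum q W f - bernSum q W g := by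
  simp [bernSum, mul_sub, Finset.sum_sub_distrib]

theorem bernSum_const_mul (q c : ℝ) (W : Finset α) (f : Finset α → ℝ) :
    bernSum q W (fun A => c * f A) = c * bernSum q W f := by
  simp only [bernSum, Finset.mul_sum]
  exact Finset.sum_congr rfl fun _ _ => by ring

theorem bernSum_sum {ι : Type*} (q : ℝ) (W : Finset α) (s : Finset ι) (f : ι → Finset α → ℝ) :
    bernSum q W (fun A => ∑ i ∈ s, f i A) = ∑ i ∈ s, bernSum q W (f i) := by
  simp only [bernSum, Finset.mul_sum]
  exact Finset.sum_comm

variable [DecidableEq α]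

theorem bernSum_insert (q : ℝ) {W : Finset α} {a : α} (ha : a ∉ W) (f : Finset α → ℝ) :
    bernSum q (insert a W) f =
      (1 - q) * bernSum q W f + q * bernSum q W fun A => f (insert a A) := by
  simp only [bernSum]
  rw [Finset.sum_powerset_insert ha, Finset.mul_sum, Finset.mul_sum]
  congr 1 <;> refine Finset.sum_congr rfl fun A hA => ?_
  · have hAW := Finset.mem_powerset.1 hA
    have : W.card + 1 - A.card = (W.card - A.card) + 1 := by
      have := Finset.card_le_card hAW; omega
    rw [Finset.card_insert_of_notMem ha, this]; ring
  · have hAW := Finset.mem_powerset.1 hA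
    rw [Finset.card_insert_of_notMem ha, Finset.card_insert_of_notMem fun h => ha (hAW h),
      Nat.add_sub_add_right]
    ring

theorem bernSum_one (q : ℝ) (W : Finset α) : bernSum q W (fun _ => 1) = 1 := by
  induction W using Finset.induction_on with
  | empty => simp [bernSum]
  | insert a W ha ih => rw [bernSum_insert q ha, ih]; ring

theorem bernSum_const (q c : ℝ) (W : Finset α) : bernSum q W (fun _ => c) = c := by
  simpa [bernSum_one] using bernSum_const_mul q c W fun _ => 1

theorem bernSum_sub_const_sq (q c : ℝ) (W : Finset α) (f : Finset α → ℝ) :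
    bernSum q W (fun A => (f A - c) ^ 2) =
      bernSum q W (fun A => f A ^ 2) - 2 * c * bernSum q W f + c ^ 2 := by
  have h : bernSum q W (fun A => (f A - c) ^ 2) =
      bernSum q W fun A => f A ^ 2 - 2 * c * f A + c ^ 2 :=
    bernSum_congr fun A _ => by ring
  rw [h, bernSum_add, bernSum_sub, bernSum_const_mul, bernSum_const]

theorem sq_bernSum_le {q : ℝ} (h0 : 0 ≤ q) (h1 : q ≤ 1) (W : Finset α) (f : Finset α → ℝ) :
    bernSum q W f ^ 2 ≤ bernSum q W fun A => f A ^ 2 := by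
  have h := bernSum_sub_const_sq q (bernSum q W f) W f
  have h' : bernSum q W (fun _ => 0) ≤ bernSum q W fun A => (f A - bernSum q W f) ^ 2 :=
    bernSum_mono h0 h1 fun A _ => sq_nonneg _
  rw [bernSum_const] at h'
  nlinarith

/-- The Poincaré (Efron–Stein) inequality for a Bernoulli random subset. -/
theorem bernSum_variance_le {q : ℝ} (h0 : 0 ≤ q) (h1 : q ≤ 1) (W : Finset α)
    (f : Finset α → ℝ) :
    bernSum q W (fun A => f A ^ 2) - bernSum q W f ^ 2 ≤
      q * (1 - q) * ∑ a ∈ W, bernSum q W fun A => (f (insert a A) - f (A.erase a)) ^ 2 := by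
  induction W using Finset.induction_on generalizing f with
  | empty => simp [bernSum]
  | insert b W hb ih =>
    have ih0 := ih f
    have ih1 := ih fun A => f (insert b A)
    have hjen := sq_bernSum_le h0 h1 W fun A => f (insert b A) - f A
    rw [bernSum_sub] at hjen
    have hB : (bernSum q (insert b W) fun A => (f (insert b A) - f (A.erase b)) ^ 2) =
        bernSum q W fun A => (f (insert b A) - f A) ^ 2 := by
      rw [bernSum_insert q hb]
      have e1 : (bernSum q W fun A => (f (insert b A) - f (A.erase b)) ^ 2) =
          bernSum q W fun A => (f (insert b A) - f A) ^ 2 :=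
        bernSum_congr fun A hA => by rw [Finset.erase_eq_of_notMem fun h => hb (hA h)]
      have e2 : (bernSum q W fun A =>
          (f (insert b (insert b A)) - f ((insert b A).erase b)) ^ 2) =
          bernSum q W fun A => (f (insert b A) - f A) ^ 2 :=
        bernSum_congr fun A hA => by
          rw [Finset.insert_idem, Finset.erase_insert fun h => hb (hA h)]
      rw [e1, e2]; ring
    have hA : ∑ a ∈ W, bernSum q (insert b W) (fun A => (f (insert a A) - f (A.erase a)) ^ 2) =
        (1 - q) * ∑ a ∈ W, bernSum q W (fun A => (f (insert a A) - f (A.erase a)) ^ 2) +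
        q * ∑ a ∈ W, bernSum q W
          (fun A => (f (insert b (insert a A)) - f (insert b (A.erase a))) ^ 2) := by
      rw [Finset.mul_sum, Finset.mul_sum, ← Finset.sum_add_distrib]
      refine Finset.sum_congr rfl fun a ha => ?_
      rw [bernSum_insert q hb]
      congr 2
      refine bernSum_congr fun A _ => ?_
      rw [Finset.insert_comm, Finset.erase_insert_of_ne (ne_of_mem_of_not_mem ha hb).symm]
    rw [Finset.sum_insert hb, hB, hA, bernSum_insert q hb, bernSum_insert q hb]
    have hq : 0 ≤ q * (1 - q) := mul_nonneg h0 (sub_nonneg.2 h1)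
    have i0 := mul_le_mul_of_nonneg_left ih0 (sub_nonneg.2 h1)
    have i1 := mul_le_mul_of_nonneg_left ih1 h0
    have i2 := mul_le_mul_of_nonneg_left hjen hq
    linear_combination i0 + i1 + i2

/-- The fibre of a uniformly random map `V → Fin k` is a Bernoulli random subset. -/
theorem sum_fiber_eq_bernSum {V : Type*} [Fintype V] [DecidableEq V] {k : ℕ} (hk : 0 < k)
    (i : Fin k) (g : Finset V → ℝ) :
    ∑ χ : V → Fin k, ((k : ℝ) ^ Fintype.card V)⁻¹ * g (Finset.univ.filter fun v => χ v = i) =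
      bernSum (k : ℝ)⁻¹ Finset.univ g := by
  have hcard : ∀ A : Finset V,
      (Finset.univ.filter fun χ : V → Fin k => (Finset.univ.filter fun v => χ v = i) = A).card =
        (k - 1) ^ (Fintype.card V - A.card) := by
    intro A
    have : (Finset.univ.filter fun χ : V → Fin k =>
        (Finset.univ.filter fun v => χ v = i) = A) =
        Fintype.piFinset fun v => if v ∈ A then {i} else Finset.univ.erase i := by
      ext χ
      simp only [Finset.mem_filter, Finset.mem_univ, true_and, Fintype.mem_piFinset,
        Finset.ext_iff]
      refine forall_congr' fun v => ?_
      by_cases h : v ∈ A <;> simp [h]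
    rw [this, Fintype.card_piFinset]
    simp only [apply_ite Finset.card, Finset.card_singleton, Finset.card_erase_of_mem,
      Finset.mem_univ, Finset.card_univ, Fintype.card_fin]
    rw [Finset.prod_ite]
    simp only [Finset.prod_const_one, one_mul, Finset.prod_const]
    congr 1
    rw [Finset.filter_not, Finset.card_sdiff_of_subset (Finset.filter_subset _ _)]
    simp
  have hk' : (k : ℝ) ≠ 0 := by positivity
  rw [bernSum, ← Finset.sum_fiberwise_of_maps_to
    (g := fun χ : V → Fin k => Finset.univ.filter fun v => χ v = i)
    (t := Finset.univ.powerset) (by simp)]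
  refine Finset.sum_congr rfl fun A _ => ?_
  rw [Finset.sum_congr rfl (g := fun _ => ((k : ℝ) ^ Fintype.card V)⁻¹ * g A)
    fun χ hχ => by rw [(Finset.mem_filter.1 hχ).2], Finset.sum_const, hcard, nsmul_eq_mul]
  have hle : A.card ≤ Fintype.card V := Finset.card_le_univ A
  obtain ⟨m, hm⟩ := Nat.exists_eq_add_of_le hle
  rw [Finset.card_univ, hm, Nat.add_sub_cancel_left, ← mul_assoc]
  congr 1
  have : (1 - (k : ℝ)⁻¹) = ((k - 1 : ℕ) : ℝ) * (k : ℝ)⁻¹ := by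
    rw [Nat.cast_sub hk]; field_simp; simp
  rw [this, mul_pow, pow_add, inv_pow, inv_pow, mul_inv, Nat.cast_pow]
  ring

end Bernoulli

section ResidualDegree

variable {V : Type*} [Fintype V] [DecidableEq V] {ρ : Sym2 V → ℕ} {E S : Finset (Sym2 V)}

/-- The edges of `S` with both endpoints in `A`. -/
noncomputable def inducedEdges (S : Finset (Sym2 V)) (A : Finset V) : Finset (Sym2 V) :=
  S.filter fun e => ∀ w ∈ e, w ∈ A

/-- The vertices of `A` left unmatched by the greedy matching of the subgraph induced on `A`. -/
noncomputable def unmatchedIn (ρ : Sym2 V → ℕ) (S : Finset (Sym2 V)) (A : Finset V) : Finset V :=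
  A.filter fun u => u ∉ matchedV (greedyMM ρ (inducedEdges S A))

/-- The number of neighbors of `v` in `unmatchedIn ρ S A`. -/
noncomputable def unmatchedNbrs (ρ : Sym2 V → ℕ) (E S : Finset (Sym2 V)) (v : V) (A : Finset V) :
    ℕ :=
  ((unmatchedIn ρ S A).filter fun u => s(u, v) ∈ E).card

theorem inducedEdges_subset (S : Finset (Sym2 V)) (A : Finset V) : inducedEdges S A ⊆ S :=
  Finset.filter_subset _ _

theorem card_neighbors_le {Δ : ℕ} (hΔ : ∀ v : V, (E.filter fun e => v ∈ e).card ≤ Δ) (u : V) :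
    (Finset.univ.filter fun v => s(u, v) ∈ E).card ≤ Δ := by
  refine le_trans (Finset.card_le_card_of_injOn (fun v => s(u, v)) ?_ ?_) (hΔ u)
  · intro v hv
    simpa using hv
  · intro v _ w _ h
    exact Sym2.congr_right.1 h

theorem card_symmDiff_unmatchedIn_le (hρ : Set.InjOn ρ S) (hdiag : ∀ e ∈ S, ¬ e.IsDiag)
    {a : V} {A : Finset V} (ha : a ∉ A) :
    (symmDiff (unmatchedIn ρ S (insert a A)) (unmatchedIn ρ S A)).card ≤ 3 := by
  have hind : inducedEdges S A = (inducedEdges S (insert a A)).filter fun e => a ∉ e := by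
    ext e
    simp only [inducedEdges, Finset.mem_filter, Finset.mem_insert, and_assoc]
    refine and_congr_right fun _ => ⟨fun h => ⟨fun w hw => Or.inr (h w hw), fun h' => ha (h a h')⟩,
      fun h w hw => (h.1 w hw).resolve_left ?_⟩
    rintro rfl
    exact h.2 hw
  have h := (statusChange_delete_vertex (inducedEdges S (insert a A))
    (hρ.mono (Finset.coe_subset.2 (inducedEdges_subset _ _)))
    (fun e he => hdiag e (inducedEdges_subset _ _ he)) a).1
  rw [← hind] at h
  have hsub : symmDiff (unmatchedIn ρ S (insert a A)) (unmatchedIn ρ S A) ⊆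
      insert a (statusChange (greedyMM ρ (inducedEdges S (insert a A)))
        (greedyMM ρ (inducedEdges S A))) := by
    intro v
    simp only [statusChange, unmatchedIn, Finset.mem_symmDiff, Finset.mem_filter,
      Finset.mem_insert]
    tauto
  exact (Finset.card_le_card hsub).trans ((Finset.card_insert_le _ _).trans (by omega))

theorem sum_sq_unmatchedNbrs_sub_le {Δ : ℕ} (hΔ : ∀ v : V, (E.filter fun e => v ∈ e).card ≤ Δ)
    (hρ : Set.InjOn ρ S) (hdiag : ∀ e ∈ S, ¬ e.IsDiag) (a : V) (A : Finset V) :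
    ∑ v, ((unmatchedNbrs ρ E S v (insert a A) : ℝ) - unmatchedNbrs ρ E S v (A.erase a)) ^ 2 ≤
      9 * Δ := by
  have hins : insert a A = insert a (A.erase a) := by
    ext v; by_cases h : v = a <;> simp [h]
  rw [hins]
  set X := unmatchedIn ρ S (insert a (A.erase a)) with hX
  set Y := unmatchedIn ρ S (A.erase a) with hY
  have hXY : (symmDiff X Y).card ≤ 3 :=
    card_symmDiff_unmatchedIn_le hρ hdiag (Finset.notMem_erase a A)
  have hterm : ∀ v, ((unmatchedNbrs ρ E S v (insert a (A.erase a)) : ℝ) -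
      unmatchedNbrs ρ E S v (A.erase a)) ^ 2 ≤
        3 * (((symmDiff X Y).filter fun u => s(u, v) ∈ E).card : ℝ) := by
    intro v
    simp only [unmatchedNbrs, ← hX, ← hY]
    have h1 : (X.filter fun u => s(u, v) ∈ E).card ≤ (Y.filter fun u => s(u, v) ∈ E).card +
        ((symmDiff X Y).filter fun u => s(u, v) ∈ E).card := by
      refine (Finset.card_le_card fun u => ?_).trans (Finset.card_union_le _ _)
      simp only [Finset.mem_filter, Finset.mem_union, Finset.mem_symmDiff]; tauto
    have h2 : (Y.filter fun u => s(u, v) ∈ E).card ≤ (X.filter fun u => s(u, v) ∈ E).card +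
        ((symmDiff X Y).filter fun u => s(u, v) ∈ E).card := by
      refine (Finset.card_le_card fun u => ?_).trans (Finset.card_union_le _ _)
      simp only [Finset.mem_filter, Finset.mem_union, Finset.mem_symmDiff]; tauto
    have h3 := (Finset.card_filter_le (symmDiff X Y) fun u => s(u, v) ∈ E).trans hXY
    have h1' : ((X.filter fun u => s(u, v) ∈ E).card : ℝ) ≤ (Y.filter fun u => s(u, v) ∈ E).card +
        ((symmDiff X Y).filter fun u => s(u, v) ∈ E).card := by exact_mod_cast h1
    have h2' : ((Y.filter fun u => s(u, v) ∈ E).card : ℝ) ≤ (X.filter fun u => s(u, v) ∈ E).card +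
        ((symmDiff X Y).filter fun u => s(u, v) ∈ E).card := by exact_mod_cast h2
    have h3' : (((symmDiff X Y).filter fun u => s(u, v) ∈ E).card : ℝ) ≤ 3 := by exact_mod_cast h3
    have h0 : (0 : ℝ) ≤ ((symmDiff X Y).filter fun u => s(u, v) ∈ E).card := Nat.cast_nonneg _
    refine (sq_le_sq' (b := (((symmDiff X Y).filter fun u => s(u, v) ∈ E).card : ℝ))
      (by linarith) (by linarith)).trans ?_
    nlinarith
  have hcount : ∑ v, ((symmDiff X Y).filter fun u => s(u, v) ∈ E).card ≤ 3 * Δ := by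
    simp only [Finset.card_filter]
    rw [Finset.sum_comm]
    simp only [← Finset.card_filter]
    refine (Finset.sum_le_card_nsmul _ _ Δ fun u _ => card_neighbors_le hΔ u).trans ?_
    rw [smul_eq_mul]
    exact Nat.mul_le_mul_right _ hXY
  calc _ ≤ ∑ v, 3 * (((symmDiff X Y).filter fun u => s(u, v) ∈ E).card : ℝ) :=
        Finset.sum_le_sum fun v _ => hterm v
    _ = 3 * ((∑ v, ((symmDiff X Y).filter fun u => s(u, v) ∈ E).card : ℕ) : ℝ) := by
        rw [← Finset.mul_sum]; push_cast; rfl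
    _ ≤ 3 * ((3 * Δ : ℕ) : ℝ) := by gcongr
    _ = 9 * Δ := by push_cast; ring

/-- The variances of `unmatchedNbrs ρ E S v A`, for a Bernoulli random `A`, add up to at most
`9 * Δ` per vertex. -/
theorem sum_variance_unmatchedNbrs_le {Δ : ℕ}
    (hΔ : ∀ v : V, (E.filter fun e => v ∈ e).card ≤ Δ) (hρ : Set.InjOn ρ S)
    (hdiag : ∀ e ∈ S, ¬ e.IsDiag) {q : ℝ} (h0 : 0 ≤ q) (h1 : q ≤ 1) :
    ∑ v, bernSum q Finset.univ (fun A => ((unmatchedNbrs ρ E S v A : ℝ) -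
      bernSum q Finset.univ fun A => (unmatchedNbrs ρ E S v A : ℝ)) ^ 2) ≤
      Fintype.card V * (9 * Δ) := by
  calc _ ≤ ∑ v, q * (1 - q) * ∑ a, bernSum q Finset.univ (fun A =>
        ((unmatchedNbrs ρ E S v (insert a A) : ℝ) - unmatchedNbrs ρ E S v (A.erase a)) ^ 2) := by
        refine Finset.sum_le_sum fun v _ => ?_
        have h := bernSum_variance_le h0 h1 Finset.univ
          fun A => (unmatchedNbrs ρ E S v A : ℝ)
        rw [bernSum_sub_const_sq]
        linarith
    _ = q * (1 - q) * ∑ a, bernSum q Finset.univ (fun A => ∑ v,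
        ((unmatchedNbrs ρ E S v (insert a A) : ℝ) - unmatchedNbrs ρ E S v (A.erase a)) ^ 2) := by
        rw [← Finset.mul_sum, Finset.sum_comm]
        exact congrArg _ (Finset.sum_congr rfl fun a _ => (bernSum_sum _ _ _ _).symm)
    _ ≤ q * (1 - q) * ∑ _a : V, (9 * Δ : ℝ) := by
        refine mul_le_mul_of_nonneg_left (Finset.sum_le_sum fun a _ => ?_)
          (mul_nonneg h0 (sub_nonneg.2 h1))
        refine (bernSum_mono h0 h1 fun A _ =>
          sum_sq_unmatchedNbrs_sub_le hΔ hρ hdiag a A).trans ?_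
        rw [bernSum_const]
    _ ≤ 1 * ∑ _a : V, (9 * Δ : ℝ) := by
        gcongr
        nlinarith
    _ = _ := by simp

/-- The edges of `E` at `v` whose endpoints are all left unmatched within `A`. -/
noncomputable def freeEdges (ρ : Sym2 V → ℕ) (E S : Finset (Sym2 V)) (v : V) (A : Finset V) :
    Finset (Sym2 V) :=
  E.filter fun e => v ∈ e ∧ ∀ w ∈ e, w ∈ unmatchedIn ρ S A

theorem notMem_of_forall_mem_unmatchedIn (hρ : Set.InjOn ρ S) {A : Finset V} {e : Sym2 V}
    (h : ∀ w ∈ e, w ∈ unmatchedIn ρ S A) : e ∉ S := fun he =>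
  notMem_of_forall_notMem_matchedV (hρ.mono (Finset.coe_subset.2 (inducedEdges_subset S A)))
    (fun w hw => (Finset.mem_filter.1 (h w hw)).2)
    (Finset.mem_filter.2 ⟨he, fun w hw => (Finset.mem_filter.1 (h w hw)).1⟩)

theorem mem_greedyMM_insert_of_forall_mem_unmatchedIn {A : Finset V} {e : Sym2 V}
    (hρ : Set.InjOn ρ (insert e S : Finset (Sym2 V)))
    (h : ∀ w ∈ e, w ∈ unmatchedIn ρ S A) : e ∈ greedyMM ρ (inducedEdges (insert e S) A) := by
  have hind : inducedEdges (insert e S) A = insert e (inducedEdges S A) :=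
    (Finset.filter_insert _ _ _).trans (if_pos fun w hw => (Finset.mem_filter.1 (h w hw)).1)
  rw [hind, greedyMM_insert_of_unmatched _ fun w hw => (Finset.mem_filter.1 (h w hw)).2]
  · exact Finset.mem_insert_self _ _
  · exact hρ.mono (Finset.coe_subset.2 (Finset.insert_subset_insert _ (inducedEdges_subset S A)))

theorem mul_bernSum_card_freeEdges_le (hρ : Set.InjOn ρ E) {p : ℝ} (h0 : 0 ≤ p) (h1 : p ≤ 1)
    (v : V) (A : Finset V) :
    p * bernSum p E (fun S => ((freeEdges ρ E S v A).card : ℝ)) ≤ 1 := by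
  have hedge : ∀ e ∈ E, p * bernSum p E (fun S =>
      if ∀ w ∈ e, w ∈ unmatchedIn ρ S A then (1 : ℝ) else 0) ≤
        bernSum p E fun S => if e ∈ greedyMM ρ (inducedEdges S A) then 1 else 0 := by
    intro e he
    obtain ⟨E', heE', rfl⟩ : ∃ E', e ∉ E' ∧ insert e E' = E :=
      ⟨E.erase e, Finset.notMem_erase _ _, Finset.insert_erase he⟩
    have hρ' : ∀ S ⊆ E', Set.InjOn ρ (insert e S : Finset (Sym2 V)) := fun S hS =>
      hρ.mono (Finset.coe_subset.2 (Finset.insert_subset_insert _ hS))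
    rw [bernSum_insert p heE', bernSum_insert p heE']
    have hz : (bernSum p E' fun S =>
        if ∀ w ∈ e, w ∈ unmatchedIn ρ (insert e S) A then (1 : ℝ) else 0) = 0 := by
      refine (bernSum_congr fun S hS => ?_).trans (bernSum_const p 0 E')
      refine if_neg fun h => ?_
      exact notMem_of_forall_mem_unmatchedIn (hρ' S hS) h (Finset.mem_insert_self _ _)
    have hle : (bernSum p E' fun S => if ∀ w ∈ e, w ∈ unmatchedIn ρ S A then (1 : ℝ) else 0) ≤
        bernSum p E' fun S =>
          if e ∈ greedyMM ρ (inducedEdges (insert e S) A) then 1 else 0 := by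
      refine bernSum_mono h0 h1 fun S hS => ?_
      split_ifs with h h'
      · exact le_rfl
      · exact absurd (mem_greedyMM_insert_of_forall_mem_unmatchedIn (hρ' S hS) h) h'
      · exact zero_le_one
      · exact le_rfl
    have hn : ∀ (P : Finset (Sym2 V) → Prop) [DecidablePred P],
        0 ≤ bernSum p E' fun S => if P S then (1 : ℝ) else 0 := fun P _ => by
      refine (bernSum_const p 0 E').ge.trans (bernSum_mono h0 h1 fun S _ => ?_)
      split_ifs <;> norm_num
    have hn1 := hn fun S => ∀ w ∈ e, w ∈ unmatchedIn ρ S A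
    have hn2 := hn fun S => e ∈ greedyMM ρ (inducedEdges S A)
    rw [hz]
    have i1 := mul_le_mul_of_nonneg_left hle h0
    have i2 := mul_nonneg (sub_nonneg.2 h1) hn2
    have i3 := mul_nonneg (mul_nonneg h0 h0) hn1
    nlinarith
  have hcard : ∀ S : Finset (Sym2 V), ((freeEdges ρ E S v A).card : ℝ) =
      ∑ e ∈ E.filter (fun e => v ∈ e), if ∀ w ∈ e, w ∈ unmatchedIn ρ S A then (1 : ℝ) else 0 := by
    intro S
    rw [freeEdges, ← Finset.filter_filter, Finset.card_filter]
    push_cast; rfl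
  simp only [hcard]
  rw [bernSum_sum, Finset.mul_sum]
  refine (Finset.sum_le_sum fun e he => hedge e (Finset.mem_filter.1 he).1).trans ?_
  rw [← bernSum_sum]
  refine (bernSum_mono h0 h1 fun S hS => ?_).trans (bernSum_one p E).le
  rw [← Finset.sum_filter, Finset.sum_const, nsmul_eq_mul, mul_one, ← Nat.cast_one,
    Nat.cast_le, Finset.card_le_one]
  intro e he f hf
  simp only [Finset.mem_filter] at he hf
  exact eq_of_mem_greedyMM
    (hρ.mono (Finset.coe_subset.2 ((inducedEdges_subset S A).trans hS))) he.2 hf.2 he.1.2 hf.1.2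

/-- The part `χ⁻¹(i)`. -/
noncomputable def part {k : ℕ} (χ : V → Fin k) (i : Fin k) : Finset V :=
  Finset.univ.filter fun v => χ v = i

theorem mem_unmatchedIn_part_iff (hρ : Set.InjOn ρ S) {k : ℕ} (χ : V → Fin k) (u : V)
    (i : Fin k) : u ∈ unmatchedIn ρ S (part χ i) ↔
      χ u = i ∧ u ∉ matchedV (algoMatching ρ k χ S) := by
  have hpart : ∀ j, (S.filter fun e => ∀ w ∈ e, χ w = j) = inducedEdges S (part χ j) := by
    intro j; ext e; simp [inducedEdges, part]
  have hmem : u ∈ part χ i ↔ χ u = i := by simp [part]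
  rw [unmatchedIn, Finset.mem_filter, hmem]
  refine and_congr_right fun hu => not_congr ?_
  simp only [algoMatching, mem_matchedV, Finset.mem_biUnion, Finset.mem_univ, true_and, hpart]
  constructor
  · rintro ⟨e, he, hue⟩
    exact ⟨e, ⟨i, he⟩, hue⟩
  · rintro ⟨e, ⟨j, he⟩, hue⟩
    have hsub := greedyMM_subset (hρ.mono (Finset.coe_subset.2 (inducedEdges_subset S _))) he
    have := (Finset.mem_filter.1 ((Finset.mem_filter.1 hsub).2 u hue)).2
    obtain rfl : j = i := this.symm.trans hu
    exact ⟨e, he, hue⟩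

theorem resDeg_algoMatching_le (hρ : Set.InjOn ρ S) {k : ℕ} (χ : V → Fin k) (v : V) :
    resDeg E (algoMatching ρ k χ S) v ≤ ∑ i, unmatchedNbrs ρ E S v (part χ i) := by
  set N := matchedV (algoMatching ρ k χ S) with hN
  have hsum : ∑ i, unmatchedNbrs ρ E S v (part χ i) =
      (Finset.univ.filter fun u => s(u, v) ∈ E ∧ u ∉ N).card := by
    rw [Finset.card_eq_sum_card_fiberwise (f := χ) (t := Finset.univ) (by simp)]
    refine Finset.sum_congr rfl fun i _ => ?_
    rw [unmatchedNbrs]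
    congr 1
    ext u
    simp only [Finset.mem_filter, mem_unmatchedIn_part_iff hρ, Finset.mem_univ, true_and]
    tauto
  rw [hsum, resDeg, ← hN]
  split_ifs
  · exact Nat.zero_le _
  refine (Finset.card_le_card fun e he => ?_).trans
    (Finset.card_image_le (f := fun u => s(u, v)))
  obtain ⟨heE, ⟨u, rfl⟩, hw⟩ := Finset.mem_filter.1 he
  rw [Finset.mem_image]
  refine ⟨u, ?_, Sym2.eq_swap⟩
  rw [Finset.mem_filter, Sym2.eq_swap]
  exact ⟨Finset.mem_univ _, heE, hw u (by simp)⟩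

theorem unmatchedNbrs_part_le_card_freeEdges (hρ : Set.InjOn ρ S) {k : ℕ} (χ : V → Fin k) {v : V}
    (hv : v ∉ matchedV (algoMatching ρ k χ S)) :
    unmatchedNbrs ρ E S v (part χ (χ v)) ≤ (freeEdges ρ E S v (part χ (χ v))).card := by
  have hv' := (mem_unmatchedIn_part_iff hρ χ v (χ v)).2 ⟨rfl, hv⟩
  refine Finset.card_le_card_of_injOn (fun u => s(u, v)) (fun u hu => ?_) fun u _ w _ h => ?_
  · obtain ⟨hu1, hu2⟩ := Finset.mem_filter.1 hu
    refine Finset.mem_filter.2 ⟨hu2, by simp, fun w hw => ?_⟩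
    rcases Sym2.mem_iff.1 hw with rfl | rfl
    · exact hu1
    · exact hv'
  · exact Sym2.congr_left.1 h

/-- If the sum of `f` exceeds `T`, then either the value at `j` is large or `f` deviates from
any constant. -/
theorem one_le_of_lt_sum {k : ℕ} (f : Fin k → ℝ) (j : Fin k) {T : ℝ} (hT : 0 < T)
    (hf : T < ∑ i, f i) (μ : ℝ) :
    1 ≤ 2 * k / T * max (f j) 0 + 16 * (k : ℝ) ^ 2 / T ^ 2 * ∑ i, (f i - μ) ^ 2 := by
  have hk : 0 < k := j.pos
  have hk1 : (1 : ℝ) ≤ k := by exact_mod_cast hk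
  have hD : 0 ≤ ∑ i, (f i - μ) ^ 2 := Finset.sum_nonneg fun _ _ => sq_nonneg _
  rcases le_or_gt (T / 2) (k * f j) with h | h
  · have : 1 ≤ 2 * k / T * max (f j) 0 := by
      rw [div_mul_eq_mul_div, le_div_iff₀ hT]
      have := mul_le_mul_of_nonneg_left (le_max_left (f j) 0) (by positivity : (0 : ℝ) ≤ k)
      linarith
    have : 0 ≤ 16 * (k : ℝ) ^ 2 / T ^ 2 * ∑ i, (f i - μ) ^ 2 := by positivity
    linarith
  · have hcs : (∑ i, (f i - μ)) ^ 2 ≤ k * ∑ i, (f i - μ) ^ 2 := by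
      simpa using sq_sum_le_card_mul_sum_sq (s := Finset.univ) (f := fun i => f i - μ)
    have hj : (f j - μ) ^ 2 ≤ ∑ i, (f i - μ) ^ 2 :=
      Finset.single_le_sum (f := fun i => (f i - μ) ^ 2) (fun _ _ => sq_nonneg _)
        (Finset.mem_univ j)
    have hsum : ∑ i, f i - k * f j = ∑ i, (f i - μ) - k * (f j - μ) := by
      rw [Finset.sum_sub_distrib]; simp; ring
    set D := ∑ i, (f i - μ) ^ 2
    have hT2 : T / 2 < ∑ i, (f i - μ) - k * (f j - μ) := by linarith
    have hsq : (T / 2) ^ 2 ≤ (∑ i, (f i - μ) - k * (f j - μ)) ^ 2 := by gcongr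
    have h2 : (∑ i, (f i - μ) - k * (f j - μ)) ^ 2 ≤
        2 * (∑ i, (f i - μ)) ^ 2 + 2 * (k ^ 2 * (f j - μ) ^ 2) := by
      nlinarith [sq_nonneg (∑ i, (f i - μ) + k * (f j - μ))]
    have h3 : (k : ℝ) ^ 2 * (f j - μ) ^ 2 ≤ k ^ 2 * D := by gcongr
    have h4 : (k : ℝ) * D ≤ k ^ 2 * D := by
      gcongr; nlinarith
    have : 1 ≤ 16 * (k : ℝ) ^ 2 / T ^ 2 * D := by
      rw [div_mul_eq_mul_div, le_div_iff₀ (by positivity)]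
      linarith
    have : 0 ≤ 2 * k / T * max (f j) 0 := by positivity
    linarith

theorem card_high_resDeg_le (hρ : Set.InjOn ρ S) {k : ℕ} (χ : V → Fin k) {T : ℝ} (hT : 0 < T)
    (μ : V → ℝ) :
    ((Finset.univ.filter fun v : V =>
      T < (resDeg E (algoMatching ρ k χ S) v : ℝ)).card : ℝ) ≤
      2 * k / T * ∑ v, ((freeEdges ρ E S v (part χ (χ v))).card : ℝ) +
        16 * (k : ℝ) ^ 2 / T ^ 2 *
          ∑ v, ∑ i, ((unmatchedNbrs ρ E S v (part χ i) : ℝ) - μ v) ^ 2 := by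
  rw [Finset.card_filter, Nat.cast_sum, Finset.mul_sum, Finset.mul_sum, ← Finset.sum_add_distrib]
  refine Finset.sum_le_sum fun v _ => ?_
  split_ifs with h
  · have hv : v ∉ matchedV (algoMatching ρ k χ S) := by
      intro hv
      rw [resDeg, if_pos hv, Nat.cast_zero] at h
      exact absurd h (not_lt.2 hT.le)
    have hsum : T < ∑ i, (unmatchedNbrs ρ E S v (part χ i) : ℝ) := by
      refine h.trans_le ?_
      exact_mod_cast resDeg_algoMatching_le hρ χ v
    have hfree : ((unmatchedNbrs ρ E S v (part χ (χ v)) : ℕ) : ℝ) ≤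
        (freeEdges ρ E S v (part χ (χ v))).card := by
      exact_mod_cast unmatchedNbrs_part_le_card_freeEdges hρ χ hv
    have := one_le_of_lt_sum _ (χ v) hT hsum (μ v)
    rw [max_eq_left (Nat.cast_nonneg _)] at this
    rw [Nat.cast_one]
    refine this.trans ?_
    gcongr
  · rw [Nat.cast_zero]; positivity

/-- For fixed priorities, a bound on the expected number of vertices of large residual degree. -/
theorem expected_card_high_resDeg_le {Δ : ℕ}
    (hΔ : ∀ v : V, (E.filter fun e => v ∈ e).card ≤ Δ) (hdiag : ∀ e ∈ E, ¬ e.IsDiag)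
    (hρ : Set.InjOn ρ E) {p : ℝ} (h0 : 0 < p) (h1 : p ≤ 1) {k : ℕ} (hk : 0 < k) {T : ℝ}
    (hT : 0 < T) :
    ∑ S ∈ E.powerset, ∑ χ : V → Fin k, bwE p E S * ((k : ℝ) ^ Fintype.card V)⁻¹ *
        ((Finset.univ.filter fun v : V =>
          T < (resDeg E (algoMatching ρ k χ S) v : ℝ)).card : ℝ) ≤
      Fintype.card V * (2 * k / (p * T) + 144 * (k : ℝ) ^ 3 * Δ / T ^ 2) := by
  have hk0 : (0 : ℝ) < k := by exact_mod_cast hk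
  have hk1 : (1 : ℝ) ≤ k := by exact_mod_cast hk
  set K := ((k : ℝ) ^ Fintype.card V)⁻¹ with hK
  have hKpos : 0 ≤ K := by positivity
  have hKsum : ∑ _χ : V → Fin k, K = 1 := by
    rw [Finset.sum_const, Finset.card_univ, Fintype.card_fun, Fintype.card_fin, nsmul_eq_mul, hK,
      Nat.cast_pow, mul_inv_cancel₀ (by positivity)]
  set q := (k : ℝ)⁻¹ with hq
  set μ : Finset (Sym2 V) → V → ℝ := fun S v =>
    bernSum q Finset.univ fun A => (unmatchedNbrs ρ E S v A : ℝ) with hμ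
  have hvar : ∀ S ⊆ E, ∑ χ : V → Fin k, K *
      ∑ v, ∑ i, ((unmatchedNbrs ρ E S v (part χ i) : ℝ) - μ S v) ^ 2 ≤
        k * (Fintype.card V * (9 * Δ)) := by
    intro S hS
    have hswap : ∑ χ : V → Fin k, K *
        ∑ v, ∑ i, ((unmatchedNbrs ρ E S v (part χ i) : ℝ) - μ S v) ^ 2 =
        ∑ i : Fin k, ∑ v, ∑ χ : V → Fin k, K *
          ((unmatchedNbrs ρ E S v (part χ i) : ℝ) - μ S v) ^ 2 := by
      simp only [Finset.mul_sum]
      rw [Finset.sum_comm]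
      rw [Finset.sum_comm (s := (Finset.univ : Finset (Fin k)))]
      exact Finset.sum_congr rfl fun v _ => Finset.sum_comm
    rw [hswap]
    refine (Finset.sum_le_card_nsmul _ _ (Fintype.card V * (9 * Δ) : ℝ) fun i _ => ?_).trans ?_
    · refine le_trans (le_of_eq ?_) (sum_variance_unmatchedNbrs_le (q := q) hΔ
        (hρ.mono (Finset.coe_subset.2 hS)) (fun e he => hdiag e (hS he)) (by positivity)
        (inv_le_one_of_one_le₀ hk1))
      refine Finset.sum_congr rfl fun v _ => ?_
      exact sum_fiber_eq_bernSum hk i fun A =>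
        ((unmatchedNbrs ρ E S v A : ℝ) - μ S v) ^ 2
    · rw [Finset.card_univ, Fintype.card_fin, nsmul_eq_mul]
  have hfree : bernSum p E (fun S => ∑ χ : V → Fin k, K *
      ∑ v, ((freeEdges ρ E S v (part χ (χ v))).card : ℝ)) ≤ Fintype.card V / p := by
    rw [bernSum_sum]
    calc _ ≤ ∑ _χ : V → Fin k, K * (Fintype.card V / p) := by
          refine Finset.sum_le_sum fun χ _ => ?_
          rw [bernSum_const_mul, bernSum_sum]
          refine mul_le_mul_of_nonneg_left ?_ hKpos
          refine (Finset.sum_le_card_nsmul _ _ (1 / p) fun v _ => ?_).trans ?_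
          · rw [le_div_iff₀ h0, mul_comm]
            exact mul_bernSum_card_freeEdges_le hρ h0.le h1 v _
          · rw [Finset.card_univ, nsmul_eq_mul, mul_one_div]
      _ = _ := by rw [← Finset.sum_mul, hKsum, one_mul]
  calc _ = bernSum p E (fun S => ∑ χ : V → Fin k, K *
        ((Finset.univ.filter fun v : V =>
          T < (resDeg E (algoMatching ρ k χ S) v : ℝ)).card : ℝ)) := by
        simp only [bernSum, bwE, Finset.mul_sum, mul_assoc]
    _ ≤ bernSum p E (fun S =>
          2 * k / T * ∑ χ : V → Fin k, K *
            ∑ v, ((freeEdges ρ E S v (part χ (χ v))).card : ℝ) +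
          16 * (k : ℝ) ^ 2 / T ^ 2 * (k * (Fintype.card V * (9 * Δ)))) := by
        refine bernSum_mono h0.le h1 fun S hS => ?_
        refine le_trans ?_ (add_le_add_right (mul_le_mul_of_nonneg_left (hvar S hS)
          (by positivity)) _)
        rw [Finset.mul_sum, Finset.mul_sum, ← Finset.sum_add_distrib]
        refine Finset.sum_le_sum fun χ _ => ?_
        have := mul_le_mul_of_nonneg_left (card_high_resDeg_le (E := E)
          (hρ.mono (Finset.coe_subset.2 hS)) χ hT (μ S)) hKpos
        linarith
    _ ≤ 2 * k / T * (Fintype.card V / p) +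
          16 * (k : ℝ) ^ 2 / T ^ 2 * (k * (Fintype.card V * (9 * Δ))) := by
        rw [bernSum_add, bernSum_const_mul, bernSum_const]
        gcongr
    _ = _ := by
        field_simp
        ring

end ResidualDegree

theorem injOn_prioOf {V : Type*} [DecidableEq V] (E : Finset (Sym2 V)) (τ : Equiv.Perm (Fin E.card)) :
    Set.InjOn (prioOf E τ) E := by
  intro e he f hf h
  rw [Finset.mem_coe] at he hf
  simp only [prioOf, dif_pos he, dif_pos hf] at h
  simpa using E.equivFin.injective (τ.injective (Fin.ext h))


theorem parameter_bound {d p k : ℝ} (hd : 1 ≤ d) (hp : p = d ^ (-(0.85 : ℝ)))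
    (hk : k = d ^ (0.1 : ℝ)) :
    2 * k / (p * d ^ (0.99 : ℝ)) + 144 * k ^ 3 * d / (d ^ (0.99 : ℝ)) ^ 2 ≤
      146 / d ^ (0.03 : ℝ) := by
  have hd0 : 0 < d := by linarith
  have hfirst : 2 * k / (p * d ^ (0.99 : ℝ)) ≤ 2 * d ^ (-(0.03) : ℝ) := by
    rw [hk, hp, ← Real.rpow_add hd0, mul_div_assoc, ← Real.rpow_sub hd0]
    gcongr
    norm_num
  have hsecond : 144 * k ^ 3 * d / (d ^ (0.99 : ℝ)) ^ 2 ≤ 144 * d ^ (-(0.03) : ℝ) := by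
    have hpow : k ^ 3 * d / (d ^ (0.99 : ℝ)) ^ 2 = d ^ (-(0.68) : ℝ) := by
      rw [hk, ← Real.rpow_natCast, ← Real.rpow_natCast, ← Real.rpow_mul hd0.le,
        ← Real.rpow_mul hd0.le, ← Real.rpow_add_one hd0.ne', ← Real.rpow_sub hd0]
      norm_num
    rw [mul_assoc, mul_div_assoc, hpow]
    gcongr
    norm_num
  rw [div_eq_mul_inv 146, ← Real.rpow_neg hd0.le]
  linarith


/-- **Algorithm 1 matches almost all high-degree vertices** (Lemma 3.2, part 3).
There is a universal constant `C > 0` such that for every `n`-vertex graph `G = (V, E)`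
with maximum degree `Δ`, when Algorithm 1 is run on `G` (edge-sampling probability
`p = Δ^{-0.85}`, `k = Δ^{0.1}` parts, uniformly random permutation `π`, Bernoulli-`p`
edge sample `L`, uniformly random partition `χ : V → [k]`) producing the matching `M`,
the expected number of vertices `v ∈ V` with residual degree
`deg^res_M(v) > Δ^{0.99}` is at most `C·n/Δ^{0.03}`. -/
theorem expected_high_residual_degree_vertices :
    ∃ C : ℝ, 0 < C ∧
      ∀ (V : Type u) [Fintype V] [DecidableEq V]
        (E : Finset (Sym2 V)) (_ : ∀ e ∈ E, ¬ e.IsDiag)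
        (Δ : ℕ) (_ : ∀ v : V, (E.filter fun e => v ∈ e).card ≤ Δ) (_ : 1 ≤ Δ)
        (p : ℝ) (_ : p = (Δ : ℝ) ^ (-(0.85 : ℝ)))
        (k : ℕ) (_ : (k : ℝ) = (Δ : ℝ) ^ ((0.1 : ℝ))) (_ : 0 < k),
        (∑ τ : Equiv.Perm (Fin E.card), ∑ S ∈ E.powerset, ∑ χ : V → Fin k,
            bwE p E S * ((k : ℝ) ^ Fintype.card V)⁻¹ *
              ((Finset.univ.filter fun v : V =>
                  (Δ : ℝ) ^ ((0.99 : ℝ)) <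
                    (resDeg E (algoMatching (prioOf E τ) k χ S) v : ℝ)).card : ℝ)) /
          (Fintype.card (Equiv.Perm (Fin E.card)) : ℝ) ≤
        C * Fintype.card V / (Δ : ℝ) ^ ((0.03 : ℝ)) := by
  refine ⟨146, by norm_num, fun V _ _ E hdiag Δ hΔ hΔ1 p hp k hk hk0 => ?_⟩
  have hd : (1 : ℝ) ≤ Δ := by exact_mod_cast hΔ1
  have hd0 : (0 : ℝ) < Δ := by linarith
  have hp0 : 0 < p := hp ▸ Real.rpow_pos_of_pos hd0 _
  have hp1 : p ≤ 1 := hp ▸ Real.rpow_le_one_of_one_le_of_nonpos hd (by norm_num)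
  have hT : 0 < (Δ : ℝ) ^ (0.99 : ℝ) := Real.rpow_pos_of_pos hd0 _
  have hcard : (0 : ℝ) < Fintype.card (Equiv.Perm (Fin E.card)) :=
    Nat.cast_pos.2 Fintype.card_pos
  rw [div_le_iff₀ hcard]
  refine (Finset.sum_le_sum fun τ _ => expected_card_high_resDeg_le hΔ hdiag
    (injOn_prioOf E τ) hp0 hp1 hk0 hT).trans ?_
  rw [Finset.sum_const, Finset.card_univ, nsmul_eq_mul, mul_comm, mul_comm (146 : ℝ),
    mul_div_assoc _ (146 : ℝ)]
  exact mul_le_mul_of_nonneg_right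
    (mul_le_mul_of_nonneg_left (parameter_bound hd hp hk) (Nat.cast_nonneg _)) hcard.le
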